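/- For every integer q ≥ 2 and every nonempty bifix-free word L of length ℓ over [q], the series ∑_{m=1}^∞ c_m^ℓ q^{−2m}, ∑_{m=1}^∞ d_m^ℓ q^{−2m}, ∑_{i=0}^∞ G_ℓ(i) and ∑_{i=0}^∞ H_ℓ(i) all converge, and ∑_{m=1}^∞ c_m^ℓ q^{−2m} = ∑_{i=0}^∞ G_ℓ(i) as well as ∑_{m=1}^∞ d_m^ℓ q^{−2m} = ∑_{i=0}^∞ H_ℓ(i). -/

import Mathlib

/-- `V` is a bifix of `W`: `V` is nonempty and is both a proper prefix
and a proper suffix of `W`. -/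
def IsBifix {α : Type*} (V W : List α) : Prop :=
  V ≠ [] ∧ (∃ A, A ≠ [] ∧ W = V ++ A) ∧ (∃ B, B ≠ [] ∧ W = B ++ V)

/-- A word is bifix-free if it has no bifix. -/
def BifixFree {α : Type*} (W : List α) : Prop := ∀ V, ¬ IsBifix V W

/-- A word is a `Z₂`-instance if it has the form `ABA` with `A, B` nonempty. -/
def Z2Instance {α : Type*} (W : List α) : Prop :=
  ∃ A B : List α, A ≠ [] ∧ B ≠ [] ∧ W = A ++ B ++ A

/-- A word is `Z₂`-bifix-free if it has no bifix that is a `Z₂`-instance. -/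
def Z2BifixFree {α : Type*} (W : List α) : Prop :=
  ∀ V, ¬ (IsBifix V W ∧ Z2Instance V)

/-- For a fixed word `L`, `dCount q L n` counts the `Z₂`-bifix-free words `W` of
length `n` over `[q]` with `W = LAL` for some nonempty `A` that moreover have the
form `W = LLA′LL` for some nonempty `A′`. -/
noncomputable def dCount (q : ℕ) (L : List (Fin q)) (n : ℕ) : ℕ :=
  Nat.card {W : List (Fin q) // W.length = n ∧ (∃ A, A ≠ [] ∧ W = L ++ A ++ L) ∧
    (∃ A', A' ≠ [] ∧ W = L ++ L ++ A' ++ L ++ L) ∧ Z2BifixFree W}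

/-- For a fixed word `L`, `cCount q L n` counts the `Z₂`-bifix-free words `W` of
length `n` over `[q]` with `W = LAL` for some nonempty `A` that are not of the
form `W = LLA′LL` for a nonempty `A′`. -/
noncomputable def cCount (q : ℕ) (L : List (Fin q)) (n : ℕ) : ℕ :=
  Nat.card {W : List (Fin q) // W.length = n ∧ (∃ A, A ≠ [] ∧ W = L ++ A ++ L) ∧
    ¬ (∃ A', A' ≠ [] ∧ W = L ++ L ++ A' ++ L ++ L) ∧ Z2BifixFree W}
/-- `r(x) = qx^{2ℓ+1} − x^{4ℓ} + x^{5ℓ} − qx^{5ℓ+1} + x^{6ℓ}`. -/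
noncomputable def rPoly (q ℓ : ℕ) (x : ℝ) : ℝ :=
  q * x ^ (2 * (ℓ : ℤ) + 1) - x ^ (4 * (ℓ : ℤ)) + x ^ (5 * (ℓ : ℤ)) -
    q * x ^ (5 * (ℓ : ℤ) + 1) + x ^ (6 * (ℓ : ℤ))

/-- `s(x) = 1 − qx^{1−ℓ} + x^{−ℓ}`. -/
noncomputable def sPoly (q ℓ : ℕ) (x : ℝ) : ℝ :=
  1 - q * x ^ (1 - (ℓ : ℤ)) + x ^ (-(ℓ : ℤ))

/-- `u(x) = qx^{4ℓ+1} − x^{5ℓ} + qx^{5ℓ+1} − x^{6ℓ}`. -/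
noncomputable def uPoly (q ℓ : ℕ) (x : ℝ) : ℝ :=
  q * x ^ (4 * (ℓ : ℤ) + 1) - x ^ (5 * (ℓ : ℤ)) + q * x ^ (5 * (ℓ : ℤ) + 1) -
    x ^ (6 * (ℓ : ℤ))

/-- `v(x) = 1 − qx^{1−ℓ} + x^{−ℓ} − qx^{1−2ℓ} + x^{−2ℓ}`. -/
noncomputable def vPoly (q ℓ : ℕ) (x : ℝ) : ℝ :=
  1 - q * x ^ (1 - (ℓ : ℤ)) + x ^ (-(ℓ : ℤ)) - q * x ^ (1 - 2 * (ℓ : ℤ)) +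
    x ^ (-(2 * (ℓ : ℤ)))

/-- `G_ℓ(i) = (−1)^i r(q^{−2^{i+1}}) ∏_{j=0}^{i−1} s(q^{−2^{j+1}})
  / ∏_{k=0}^{i} (1 − q^{1−2^{k+1}})`. -/
noncomputable def Gterm (q ℓ i : ℕ) : ℝ :=
  (-1 : ℝ) ^ i * rPoly q ℓ ((q : ℝ) ^ (-(2 : ℤ) ^ (i + 1))) *
      (∏ j ∈ Finset.range i, sPoly q ℓ ((q : ℝ) ^ (-(2 : ℤ) ^ (j + 1)))) /
    ∏ k ∈ Finset.range (i + 1), (1 - (q : ℝ) ^ ((1 : ℤ) - 2 ^ (k + 1)))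

/-- `H_ℓ(i) = (−1)^i u(q^{−2^{i+1}}) ∏_{j=0}^{i−1} v(q^{−2^{j+1}})
  / ∏_{k=0}^{i} (1 − q^{1−2^{k+1}})`. -/
noncomputable def Hterm (q ℓ i : ℕ) : ℝ :=
  (-1 : ℝ) ^ i * uPoly q ℓ ((q : ℝ) ^ (-(2 : ℤ) ^ (i + 1))) *
      (∏ j ∈ Finset.range i, vPoly q ℓ ((q : ℝ) ^ (-(2 : ℤ) ^ (j + 1)))) /
    ∏ k ∈ Finset.range (i + 1), (1 - (q : ℝ) ^ ((1 : ℤ) - 2 ^ (k + 1)))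

/-- `V` is a border of `W`: a prefix that is also a suffix, possibly empty or all of `W`. -/
def IsBorder {α : Type*} (V W : List α) : Prop := V <+: W ∧ V <:+ W

section Border

variable {α : Type*} {L U V W : List α}

theorem IsBorder.length_le (h : IsBorder V W) : V.length ≤ W.length := h.1.length_le

theorem IsBorder.eq_of_length (h : IsBorder V W) (hl : V.length = W.length) : V = W :=
  h.1.eq_of_length hl

theorem IsBorder.length_lt (h : IsBorder V W) (hne : V ≠ W) : V.length < W.length :=
  lt_of_le_of_ne h.length_le fun hl => hne (h.eq_of_length hl)

theorem IsBorder.trans (hU : IsBorder U V) (hV : IsBorder V W) : IsBorder U W :=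
  ⟨hU.1.trans hV.1, hU.2.trans hV.2⟩

theorem IsBorder.of_length_le (hU : IsBorder U W) (hV : IsBorder V W)
    (h : U.length ≤ V.length) : IsBorder U V :=
  ⟨List.prefix_of_prefix_length_le hU.1 hV.1 h, List.suffix_of_suffix_length_le hU.2 hV.2 h⟩

theorem IsBorder.append_append (V M : List α) : IsBorder V (V ++ M ++ V) :=
  ⟨⟨M ++ V, by simp⟩, ⟨V ++ M, rfl⟩⟩

/-- A border at most half as long as the word splits off on both sides. -/
theorem IsBorder.exists_eq_append (h : IsBorder V W) (hl : 2 * V.length ≤ W.length) :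
    ∃ M, W = V ++ M ++ V := by
  obtain ⟨⟨R, rfl⟩, hs⟩ := h
  have hR : V <:+ R := List.suffix_of_suffix_length_le hs (List.suffix_append V R) (by
    simp at hl; omega)
  obtain ⟨M, rfl⟩ := hR
  exact ⟨M, by simp⟩

/-- A border at least half as long as the word overlaps itself in a border. -/
theorem IsBorder.exists_overlap (h : IsBorder V W) (hl : W.length ≤ 2 * V.length) :
    ∃ U, IsBorder U V ∧ U.length + W.length = 2 * V.length ∧ W = V ++ V.drop U.length := by
  obtain ⟨⟨R, rfl⟩, B, hB⟩ := h
  have hR : R <:+ V := List.suffix_of_suffix_length_le (List.suffix_append V R) ⟨B, hB⟩ (by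
    simp at hl; omega)
  obtain ⟨U, rfl⟩ := hR
  rw [← List.append_assoc, List.append_cancel_right_eq] at hB
  refine ⟨U, ⟨List.prefix_append U R, B, hB⟩, ?_, ?_⟩
  · simp; omega
  · simp

theorem IsBorder.append_drop (h : IsBorder U V) : IsBorder V (V ++ V.drop U.length) := by
  obtain ⟨⟨R, hR⟩, B, hB⟩ := h
  refine ⟨List.prefix_append _ _, B, ?_⟩
  subst hR
  rw [List.drop_left, ← List.append_assoc, hB]

theorem isBifix_iff : IsBifix V W ↔ V ≠ [] ∧ V ≠ W ∧ IsBorder V W := by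
  constructor
  · rintro ⟨h0, ⟨A, hA, h1⟩, B, -, h2⟩
    refine ⟨h0, ?_, ⟨A, h1.symm⟩, B, h2.symm⟩
    rintro rfl
    exact hA (by simpa using h1)
  · rintro ⟨h0, hne, ⟨A, h1⟩, B, h2⟩
    refine ⟨h0, ⟨A, ?_, h1.symm⟩, B, ?_, h2.symm⟩
    · rintro rfl
      exact hne (by simpa using h1)
    · rintro rfl
      exact hne (by simpa using h2)

theorem exists_append_append_iff :
    (∃ A, A ≠ [] ∧ W = U ++ A ++ U) ↔ IsBorder U W ∧ 2 * U.length < W.length := by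
  constructor
  · rintro ⟨A, hA, rfl⟩
    have := List.length_pos_iff.2 hA
    exact ⟨IsBorder.append_append U A, by simp; omega⟩
  · rintro ⟨h, hl⟩
    obtain ⟨A, rfl⟩ := h.exists_eq_append hl.le
    refine ⟨A, ?_, rfl⟩
    rintro rfl
    simp at hl
    omega

theorem z2Instance_iff :
    Z2Instance V ↔ ∃ A, A ≠ [] ∧ IsBorder A V ∧ 2 * A.length < V.length := by
  simp only [← exists_append_append_iff, Z2Instance]
  constructor
  · rintro ⟨A, B, hA, hB, h⟩
    exact ⟨A, hA, B, hB, h⟩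
  · rintro ⟨A, hA, B, hB, h⟩
    exact ⟨A, B, hA, hB, h⟩

theorem BifixFree.eq_of_isBorder (hL : BifixFree L) (h : IsBorder U L) (h0 : U ≠ []) : U = L := by
  by_contra hne
  exact hL U (isBifix_iff.2 ⟨h0, hne, h⟩)

/-- A bifix-free border is a border of every other nonempty border. -/
theorem BifixFree.isBorder_of_isBorder (hL : BifixFree L) (h : IsBorder L W) (hV : IsBorder V W)
    (h0 : V ≠ []) : IsBorder L V := by
  rcases le_total L.length V.length with hl | hl
  · exact h.of_length_le hV hl
  · rw [hL.eq_of_isBorder (hV.of_length_le h hl) h0]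
    exact ⟨List.prefix_refl L, List.suffix_refl L⟩

theorem BifixFree.eq_or_length_le (hL : BifixFree L) (h : IsBorder L V) :
    V = L ∨ 2 * L.length ≤ V.length := by
  by_contra! hc
  obtain ⟨U, hU, hlen, rfl⟩ := h.exists_overlap hc.2.le
  have hne : U ≠ [] := by
    rintro rfl
    simp at hlen hc
    omega
  have := hL.eq_of_isBorder hU hne
  subst this
  simp at hc

theorem IsBorder.eq_append_self (h : IsBorder L V) (hl : V.length = 2 * L.length) :
    V = L ++ L := by
  obtain ⟨M, rfl⟩ := h.exists_eq_append hl.ge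
  have : M = [] := by
    rw [← List.length_eq_zero_iff]
    simp at hl
    omega
  simp [this]

theorem z2BifixFree_iff (hL : BifixFree L) (h0 : L ≠ []) (h : IsBorder L W) :
    Z2BifixFree W ↔ ∀ V, IsBorder V W → V ≠ W → V.length ≤ 2 * L.length := by
  constructor
  · intro hW V hV hne
    by_contra! hlt
    have hV0 : V ≠ [] := by
      rintro rfl
      simp at hlt
    exact hW V ⟨isBifix_iff.2 ⟨hV0, hne, hV⟩, z2Instance_iff.2
      ⟨L, h0, hL.isBorder_of_isBorder h hV hV0, hlt⟩⟩
  · rintro hW V ⟨hV, hZ⟩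
    obtain ⟨-, hne, hV⟩ := isBifix_iff.1 hV
    obtain ⟨A, hA0, hA, hlt⟩ := z2Instance_iff.1 hZ
    have h1 := hW V hV hne
    have h2 := (hL.isBorder_of_isBorder h (hA.trans hV) hA0).length_le
    omega

/-- The words `W = LAL` with `A` nonempty. -/
def sandwich (L : List α) : Set (List α) := {W | IsBorder L W ∧ 2 * L.length < W.length}

/-- The `Z₂`-bifix-free words `W = LAL` with `A` nonempty. -/
def primitiveWords (L : List α) : Set (List α) := {W | W ∈ sandwich L ∧ Z2BifixFree W}

theorem mem_primitiveWords_iff (hL : BifixFree L) (h0 : L ≠ []) :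
    W ∈ primitiveWords L ↔ W ∈ sandwich L ∧
      ∀ V, IsBorder V W → V ≠ W → V.length ≤ 2 * L.length :=
  and_congr_right fun h => z2BifixFree_iff hL h0 h.1

/-- Every word has at most one border in `primitiveWords L`. -/
theorem primitiveWords_border_unique (hL : BifixFree L) (h0 : L ≠ [])
    (hU : U ∈ primitiveWords L) (hV : V ∈ primitiveWords L) (hUW : IsBorder U W)
    (hVW : IsBorder V W) : U = V := by
  wlog hl : U.length ≤ V.length generalizing U V
  · exact (this hV hU hVW hUW (by omega)).symm
  by_contra hne
  have := ((mem_primitiveWords_iff hL h0).1 hV).2 U (hUW.of_length_le hVW hl) hne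
  have := hU.1.2
  omega

/-- A word of the form `LAL` that is not `Z₂`-bifix-free has a border `V` in `primitiveWords L`,
and the two occurrences of `V` are disjoint or overlap in `L` or in `LL`. -/
theorem exists_primitive_border (hL : BifixFree L) (h0 : L ≠ []) (hW : W ∈ sandwich L)
    (hWp : W ∉ primitiveWords L) : ∃ V ∈ primitiveWords L, (∃ M, W = V ++ M ++ V) ∨
      W = V ++ V.drop L.length ∨
      (IsBorder (L ++ L) V ∧ W = V ++ V.drop (2 * L.length)) := by
  classical
  have hex : ∃ n, ∃ V, IsBorder V W ∧ V ≠ W ∧ 2 * L.length < V.length ∧ V.length = n := by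
    by_contra! hc
    exact hWp ((mem_primitiveWords_iff hL h0).2 ⟨hW, fun V hV hne => by
      by_contra! hlt
      exact hc _ V hV hne hlt rfl⟩)
  obtain ⟨V, hV, hne, hlt, hn⟩ := Nat.find_spec hex
  have hmin : ∀ U, IsBorder U V → U ≠ V → U.length ≤ 2 * L.length := by
    intro U hU hUV
    by_contra! hc
    have hl := hU.length_lt hUV
    have := hV.length_le
    refine Nat.find_min hex (m := U.length) (by omega) ⟨U, hU.trans hV, ?_, hc, rfl⟩
    rintro rfl
    omega
  have hLV : IsBorder L V := hW.1.of_length_le hV (by omega)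
  refine ⟨V, (mem_primitiveWords_iff hL h0).2 ⟨⟨hLV, hlt⟩, hmin⟩, ?_⟩
  rcases le_or_gt (2 * V.length) W.length with hl | hl
  · exact Or.inl (hV.exists_eq_append hl)
  right
  obtain ⟨U, hU, hlen, hWU⟩ := hV.exists_overlap hl.le
  have hVW := hV.length_lt hne
  have hU0 : U ≠ [] := by
    rintro rfl
    simp at hlen
    omega
  have hUl := hmin U hU (by rintro rfl; omega)
  have hLU := hL.isBorder_of_isBorder hLV hU hU0
  rcases hL.eq_or_length_le hLU with rfl | hge
  · exact Or.inl hWU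
  · have hUl' := le_antisymm hUl hge
    rw [hUl'] at hWU
    exact Or.inr ⟨hLU.eq_append_self hUl' ▸ hU, hWU⟩

theorem sandwich_append_self_subset (L : List α) : sandwich (L ++ L) ⊆ sandwich L := by
  rintro W ⟨h, hl⟩
  have hb : IsBorder L (L ++ L) := by simpa using IsBorder.append_append L []
  refine ⟨hb.trans h, ?_⟩
  simp at hl
  omega

theorem mem_sandwich_of_isBorder (hV : V ∈ sandwich L) (h : IsBorder V W) : W ∈ sandwich L :=
  ⟨hV.1.trans h, hV.2.trans_le h.length_le⟩

theorem notMem_primitiveWords (hL : BifixFree L) (h0 : L ≠ []) (hV : V ∈ sandwich L)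
    (h : IsBorder V W) (hne : V.length < W.length) : W ∉ primitiveWords L := fun hW =>
  (((mem_primitiveWords_iff hL h0).1 hW).2 V h (by rintro rfl; omega)).not_gt hV.2

theorem isBorder_append_self_triple (L : List α) : IsBorder (L ++ L) (L ++ L ++ L) :=
  ⟨List.prefix_append _ _, L, by simp⟩

/-- The only member of `primitiveWords L` bordered by `LL` but not of the form `LLALL` is `LLL`. -/
theorem eq_triple_or_mem_sandwich (hL : BifixFree L) (h0 : L ≠ []) (hV : V ∈ primitiveWords L)
    (h : IsBorder (L ++ L) V) : V = L ++ L ++ L ∨ V ∈ sandwich (L ++ L) := by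
  by_contra! hc
  have hl : V.length ≤ 2 * (L ++ L).length := by
    by_contra! hlt
    exact hc.2 ⟨h, hlt⟩
  obtain ⟨U, hU, hlen, hVU⟩ := h.exists_overlap hl
  have hV2 := hV.1.2
  rcases eq_or_ne U [] with rfl | hU0
  · have h3 : IsBorder (L ++ L ++ L) V := by
      rw [hVU]
      exact ⟨⟨L, by simp⟩, L, by simp⟩
    have h4 := ((mem_primitiveWords_iff hL h0).1 hV).2 _ h3 (fun he => hc.1 he.symm)
    have := List.length_pos_iff.2 h0
    simp at h4
    omega
  have hLU : IsBorder L U := hL.isBorder_of_isBorder (W := L ++ L)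
    (by simpa using IsBorder.append_append L []) hU hU0
  rcases hL.eq_or_length_le hLU with rfl | hge
  · exact hc.1 (by simpa using hVU)
  · simp at hlen
    omega

theorem triple_mem_primitiveWords (hL : BifixFree L) (h0 : L ≠ []) :
    L ++ L ++ L ∈ primitiveWords L := by
  have := List.length_pos_iff.2 h0
  have hb : IsBorder L (L ++ L ++ L) := IsBorder.append_append L L
  refine (mem_primitiveWords_iff hL h0).2 ⟨⟨hb, by simp; omega⟩, fun V hV hne => ?_⟩
  by_contra! hlt
  have hl := hV.length_lt hne
  obtain ⟨U, hU, hlen, hVU⟩ := hV.exists_overlap (by simp; omega)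
  have hU0 : U ≠ [] := by
    rintro rfl
    simp at hlen
    omega
  have hLV : IsBorder L V := hb.of_length_le hV (by omega)
  have hLU := hL.isBorder_of_isBorder hLV hU hU0
  have hVs : V.length < 3 * L.length := by simp at hl; omega
  simp at hlen
  obtain ⟨M, rfl⟩ := hLV.exists_eq_append hlt.le
  have hMp : M <+: L := by
    have h1 : L ++ M <+: L ++ L := List.prefix_of_prefix_length_le (l₃ := L ++ L ++ L)
      ((List.prefix_append _ _).trans hV.1) (List.prefix_append _ _) (by simp at hVs ⊢; omega)
    exact (List.prefix_append_right_inj L).1 h1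
  have hMs : M <:+ L := by
    have h1 : M ++ L <:+ L ++ L := List.suffix_of_suffix_length_le (l₃ := L ++ L ++ L)
      (List.IsSuffix.trans ⟨L, by simp⟩ hV.2) ⟨L, by simp⟩ (by simp at hVs ⊢; omega)
    obtain ⟨t, ht⟩ := h1
    exact ⟨t, by simpa [← List.append_assoc] using ht⟩
  have hM0 : M ≠ [] := by
    rintro rfl
    simp at hlt
    omega
  rw [hL.eq_of_isBorder ⟨hMp, hMs⟩ hM0] at hne
  exact hne rfl

end Border

section Decomposition

variable {α : Type*} {L U V W : List α}

/-- The words `VMV` with `V ∈ P` and `M` arbitrary. -/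
def joins (P : Set (List α)) : Set (List α) :=
  (fun p : List α × List α => p.1 ++ p.2 ++ p.1) '' (P ×ˢ Set.univ)

/-- The words obtained from two copies of some `V ∈ P` overlapping in `k` letters. -/
def overlaps (k : ℕ) (P : Set (List α)) : Set (List α) := (fun V => V ++ V.drop k) '' P

/-- The members of `primitiveWords L` not of the form `LLALL`. -/
def cWords (L : List α) : Set (List α) := primitiveWords L \ sandwich (L ++ L)

/-- The members of `primitiveWords L` of the form `LLALL`. -/
def dWords (L : List α) : Set (List α) := primitiveWords L ∩ sandwich (L ++ L)

theorem triple_mem_cWords (hL : BifixFree L) (h0 : L ≠ []) : L ++ L ++ L ∈ cWords L := by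
  refine ⟨triple_mem_primitiveWords hL h0, fun h => ?_⟩
  have := h.2
  simp at this
  omega

theorem exists_of_mem_joins {P : Set (List α)} (h : W ∈ joins P) :
    ∃ V ∈ P, ∃ M, W = V ++ M ++ V := by
  obtain ⟨⟨V, M⟩, hV, rfl⟩ := h
  exact ⟨V, hV.1, M, rfl⟩

theorem mem_joins {P : Set (List α)} (hV : V ∈ P) (M : List α) : V ++ M ++ V ∈ joins P :=
  ⟨(V, M), ⟨hV, trivial⟩, rfl⟩

theorem IsBorder.overlap (hV : V ∈ sandwich L) : IsBorder V (V ++ V.drop L.length) :=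
  hV.1.append_drop

theorem IsBorder.overlap_two (h : IsBorder (L ++ L) V) :
    IsBorder V (V ++ V.drop (2 * L.length)) := by
  have := h.append_drop
  rwa [List.length_append, ← two_mul] at this

theorem mem_sandwich_append_self (hV : V ∈ dWords L) (h : IsBorder V W) :
    W ∈ sandwich (L ++ L) :=
  mem_sandwich_of_isBorder hV.2 h

/-- Words of the form `LLALL` have no border in `cWords L` other than `LLL`. -/
theorem notMem_sandwich_append_self (hL : BifixFree L) (h0 : L ≠ []) (hV : V ∈ cWords L)
    (hne : V ≠ L ++ L ++ L) (h : IsBorder V W) : W ∉ sandwich (L ++ L) := by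
  intro hW
  have hlt := hV.1.1.2
  have h2 : IsBorder (L ++ L) V := hW.1.of_length_le h (by simp; omega)
  exact (eq_triple_or_mem_sandwich hL h0 hV.1 h2).elim hne hV.2

theorem triple_isBorder_mem_sandwich (h : IsBorder (L ++ L ++ L) W)
    (hl : 4 * L.length < W.length) : W ∈ sandwich (L ++ L) :=
  ⟨(isBorder_append_self_triple L).trans h, by simp; omega⟩

theorem quadruple_notMem_sandwich (L : List α) :
    (L ++ L ++ L) ++ (L ++ L ++ L).drop (2 * L.length) ∉ sandwich (L ++ L) := by
  intro h
  have := h.2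
  simp at this
  omega

theorem sandwich_diff_eq (hL : BifixFree L) (h0 : L ≠ []) :
    sandwich L \ sandwich (L ++ L) = cWords L ∪ (joins (cWords L \ {L ++ L ++ L}) ∪
      (overlaps L.length (cWords L \ {L ++ L ++ L}) ∪
        overlaps (2 * L.length) {L ++ L ++ L})) := by
  have hpos := List.length_pos_iff.2 h0
  ext W
  constructor
  · rintro ⟨hW, hWd⟩
    by_cases hWp : W ∈ primitiveWords L
    · exact Or.inl ⟨hWp, hWd⟩
    right
    obtain ⟨V, hV, hVW⟩ := exists_primitive_border hL h0 hW hWp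
    have hVb : IsBorder V W := by
      rcases hVW with ⟨M, rfl⟩ | rfl | ⟨h2, rfl⟩
      · exact IsBorder.append_append V M
      · exact IsBorder.overlap hV.1
      · exact h2.overlap_two
    have hVc : V ∈ cWords L := ⟨hV, fun hd => hWd (mem_sandwich_append_self ⟨hV, hd⟩ hVb)⟩
    have hlen (hle : 4 * L.length < W.length) : V ≠ L ++ L ++ L := by
      rintro rfl
      exact hWd (triple_isBorder_mem_sandwich hVb hle)
    have hV2 := hV.1.2
    rcases hVW with ⟨M, rfl⟩ | rfl | ⟨h2, rfl⟩
    · have hVP : V ∈ cWords L \ {L ++ L ++ L} := ⟨hVc, hlen (by simp; omega)⟩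
      exact Or.inl (mem_joins hVP M)
    · refine Or.inr (Or.inl ⟨V, ⟨hVc, ?_⟩, rfl⟩)
      rintro rfl
      exact hlen (by simp; omega) rfl
    · rcases eq_triple_or_mem_sandwich hL h0 hV h2 with rfl | hd
      · exact Or.inr (Or.inr ⟨_, rfl, rfl⟩)
      · exact absurd hd hVc.2
  · rintro (h | h | ⟨V, ⟨hV, hne⟩, rfl⟩ | ⟨V, rfl, rfl⟩)
    · exact ⟨h.1.1, h.2⟩
    · obtain ⟨V, ⟨hV, hne⟩, M, rfl⟩ := exists_of_mem_joins h
      have hb := IsBorder.append_append V M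
      exact ⟨mem_sandwich_of_isBorder hV.1.1 hb, notMem_sandwich_append_self hL h0 hV hne hb⟩
    · have hb := IsBorder.overlap hV.1.1
      exact ⟨mem_sandwich_of_isBorder hV.1.1 hb, notMem_sandwich_append_self hL h0 hV hne hb⟩
    · exact ⟨mem_sandwich_of_isBorder (triple_mem_primitiveWords hL h0).1
        (isBorder_append_self_triple L).overlap_two, quadruple_notMem_sandwich L⟩

theorem sandwich_append_self_eq (hL : BifixFree L) (h0 : L ≠ []) :
    sandwich (L ++ L) = dWords L ∪ (joins (insert (L ++ L ++ L) (dWords L)) ∪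
      (overlaps L.length (insert (L ++ L ++ L) (dWords L)) ∪
        overlaps (2 * L.length) (dWords L))) := by
  have hpos := List.length_pos_iff.2 h0
  have hT := triple_mem_primitiveWords hL h0
  ext W
  constructor
  · intro hWd
    by_cases hWp : W ∈ primitiveWords L
    · exact Or.inl ⟨hWp, hWd⟩
    right
    obtain ⟨V, hV, hVW⟩ :=
      exists_primitive_border hL h0 (sandwich_append_self_subset L hWd) hWp
    have hVd (hVb : IsBorder V W) : V ∈ insert (L ++ L ++ L) (dWords L) := by
      by_contra hc
      rw [Set.mem_insert_iff, not_or] at hc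
      exact notMem_sandwich_append_self hL h0 ⟨hV, fun h => hc.2 ⟨hV, h⟩⟩ hc.1 hVb hWd
    rcases hVW with ⟨M, rfl⟩ | rfl | ⟨h2, rfl⟩
    · exact Or.inl (mem_joins (hVd (IsBorder.append_append V M)) M)
    · exact Or.inr (Or.inl ⟨V, hVd (IsBorder.overlap hV.1), rfl⟩)
    · rcases eq_triple_or_mem_sandwich hL h0 hV h2 with rfl | hd
      · exact absurd hWd (quadruple_notMem_sandwich L)
      · exact Or.inr (Or.inr ⟨V, ⟨hV, hd⟩, rfl⟩)
  · rintro (h | h | ⟨V, rfl | hV, rfl⟩ | ⟨V, hV, rfl⟩)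
    · exact h.2
    · obtain ⟨V, hV | hV, M, rfl⟩ := exists_of_mem_joins h
      · subst hV
        exact triple_isBorder_mem_sandwich (IsBorder.append_append _ M) (by simp; omega)
      · exact mem_sandwich_append_self hV (IsBorder.append_append V M)
    · exact triple_isBorder_mem_sandwich (IsBorder.overlap hT.1) (by simp; omega)
    · exact mem_sandwich_append_self hV (IsBorder.overlap hV.1.1)
    · exact mem_sandwich_append_self hV hV.2.1.overlap_two

end Decomposition

section GeneratingFunction

variable {α : Type*} {L : List α} {y : ℝ}

/-- The generating function of a set of words by length. -/
noncomputable def wordGF (y : ℝ) (S : Set (List α)) : ℝ := ∑' W : S, y ^ W.1.length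

theorem wordGF_union {S T : Set (List α)} (hy : Summable fun W : List α => y ^ W.length)
    (h : Disjoint S T) : wordGF y (S ∪ T) = wordGF y S + wordGF y T :=
  Summable.tsum_union_disjoint h (hy.subtype S) (hy.subtype T)

theorem wordGF_mono {S T : Set (List α)} (h0 : 0 ≤ y)
    (hy : Summable fun W : List α => y ^ W.length) (h : S ⊆ T) :
    wordGF y S ≤ wordGF y T :=
  Summable.tsum_le_tsum_of_inj (Set.inclusion h) (Set.inclusion_injective h)
    (fun _ _ => pow_nonneg h0 _) (fun _ => le_rfl) (hy.subtype S) (hy.subtype T)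

theorem wordGF_nonneg (h0 : 0 ≤ y) (S : Set (List α)) : 0 ≤ wordGF y S :=
  tsum_nonneg fun _ => pow_nonneg h0 _

theorem wordGF_singleton (W : List α) : wordGF y {W} = y ^ W.length :=
  tsum_singleton W fun W : List α => y ^ W.length

theorem wordGF_diff_singleton {S : Set (List α)}
    (hy : Summable fun W : List α => y ^ W.length) {V : List α} (h : V ∈ S) :
    wordGF y (S \ {V}) = wordGF y S - y ^ V.length := by
  have := wordGF_union hy (Set.disjoint_sdiff_left (s := {V}) (t := S))
  rw [Set.sdiff_union_of_subset (by simpa using h), wordGF_singleton] at this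
  linarith

theorem wordGF_insert {S : Set (List α)}
    (hy : Summable fun W : List α => y ^ W.length) {V : List α} (h : V ∉ S) :
    wordGF y (insert V S) = wordGF y S + y ^ V.length := by
  rw [← Set.union_singleton, wordGF_union hy (by simpa using h), wordGF_singleton]

theorem wordGF_sandwich (hy : Summable fun W : List α => y ^ W.length) (L : List α) :
    wordGF y (sandwich L) = y ^ (2 * L.length) * (wordGF y (Set.univ : Set (List α)) - 1) := by
  have himg : sandwich L = (fun A => L ++ A ++ L) '' (Set.univ \ {[]}) := by
    ext W
    simp only [sandwich, Set.mem_ofPred_eq, ← exists_append_append_iff, Set.mem_image,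
      Set.mem_sdiff, Set.mem_univ, true_and, Set.mem_singleton_iff]
    exact exists_congr fun A => and_congr_right fun _ => eq_comm
  have h1 := wordGF_diff_singleton hy (Set.mem_univ ([] : List α))
  simp only [List.length_nil, pow_zero] at h1
  rw [← h1, himg, wordGF, tsum_image (fun W : List α => y ^ W.length)
    (fun A _ B _ h => by simpa using h), wordGF, ← tsum_mul_left]
  refine tsum_congr fun A => ?_
  rw [← pow_add]
  congr 1
  simp
  omega

theorem wordGF_overlaps (h0 : y ≠ 0) {P : Set (List α)} {k : ℕ}
    (hk : ∀ V ∈ P, k ≤ V.length) :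
    wordGF y (overlaps k P) = wordGF (y ^ 2) P * (y ^ k)⁻¹ := by
  have hinj : Set.InjOn (fun V : List α => V ++ V.drop k) P := by
    intro U hU V hV h
    have hl := congrArg List.length h
    simp only [List.length_append, List.length_drop] at hl
    have := hk U hU
    have := hk V hV
    exact (List.append_inj h (by omega)).1
  rw [overlaps, wordGF, tsum_image (fun W : List α => y ^ W.length) hinj, wordGF,
    ← tsum_mul_right]
  refine tsum_congr fun V => ?_
  have := hk V.1 V.2
  rw [eq_mul_inv_iff_mul_eq₀ (pow_ne_zero k h0), ← pow_add, ← pow_mul]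
  congr 1
  simp
  omega

theorem wordGF_joins (hL : BifixFree L) (hne : L ≠ []) (h0 : 0 ≤ y)
    (hy : Summable fun W : List α => y ^ W.length)
    (hy2 : Summable fun W : List α => (y ^ 2) ^ W.length)
    {P : Set (List α)} (hP : P ⊆ primitiveWords L) :
    wordGF y (joins P) = wordGF (y ^ 2) P * wordGF y (Set.univ : Set (List α)) := by
  have hinj : Set.InjOn (fun p : List α × List α => p.1 ++ p.2 ++ p.1) (P ×ˢ Set.univ) := by
    rintro ⟨U, M⟩ hU ⟨V, N⟩ hV h
    have hUV : U = V := primitiveWords_border_unique hL hne (hP hU.1) (hP hV.1)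
      (W := U ++ M ++ U) (IsBorder.append_append U M)
      (by rw [show U ++ M ++ U = V ++ N ++ V from h]; exact IsBorder.append_append V N)
    subst hUV
    simpa using h
  have hu : wordGF y (Set.univ : Set (List α)) = ∑' W : List α, y ^ W.length :=
    tsum_univ fun W : List α => y ^ W.length
  rw [joins, wordGF, tsum_image (fun W : List α => y ^ W.length) hinj, hu, wordGF]
  have hs : Summable fun p : P × List α => (y ^ 2) ^ p.1.1.length * y ^ p.2.length :=
    (hy2.subtype P).mul_of_nonneg hy (fun _ => pow_nonneg (sq_nonneg y) _)
      (fun _ => pow_nonneg h0 _)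
  rw [show (∑' W : P, (y ^ 2) ^ W.1.length) * ∑' W : List α, y ^ W.length = _ from
    (hy2.subtype P).tsum_mul_tsum hy hs]
  let e : P × List α ≃ (P ×ˢ (Set.univ : Set (List α)) : Set (List α × List α)) :=
    { toFun := fun p => ⟨(p.1.1, p.2), p.1.2, trivial⟩
      invFun := fun p => (⟨p.1.1, p.2.1⟩, p.1.2)
      left_inv := fun _ => rfl
      right_inv := fun _ => rfl }
  rw [← e.tsum_eq]
  refine tsum_congr fun p => ?_
  simp only [e, Equiv.coe_fn_mk, Function.comp_apply]
  rw [← pow_mul, ← pow_add]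
  congr 1
  simp
  omega

theorem wordGF_decomposition (hL : BifixFree L) (hne : L ≠ []) (h0 : 0 < y)
    (hy : Summable fun W : List α => y ^ W.length)
    (hy2 : Summable fun W : List α => (y ^ 2) ^ W.length)
    {S P R : Set (List α)} (hS : S ⊆ primitiveWords L) (hP : P ⊆ primitiveWords L)
    (hR : R ⊆ primitiveWords L) (hR2 : ∀ V ∈ R, IsBorder (L ++ L) V) :
    wordGF y (S ∪ (joins P ∪ (overlaps L.length P ∪ overlaps (2 * L.length) R))) =
      wordGF y S + wordGF (y ^ 2) P * wordGF y (Set.univ : Set (List α)) +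
        wordGF (y ^ 2) P * (y ^ L.length)⁻¹ +
        wordGF (y ^ 2) R * (y ^ (2 * L.length))⁻¹ := by
  have hpos := List.length_pos_iff.2 hne
  have d1 : Disjoint (overlaps L.length P) (overlaps (2 * L.length) R) := by
    rw [Set.disjoint_left]
    rintro _ ⟨U, hU, rfl⟩ ⟨V, hV, h⟩
    have hUV : U = V := primitiveWords_border_unique hL hne (hP hU) (hR hV)
      (IsBorder.overlap (hP hU).1) (by simpa only [h] using (hR2 V hV).overlap_two)
    subst hUV
    have h1 := congrArg List.length h
    have h2 := (hP hU).1.2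
    simp at h1
    omega
  have d2 : Disjoint (joins P) (overlaps L.length P ∪ overlaps (2 * L.length) R) := by
    rw [Set.disjoint_left]
    rintro W hW hW'
    obtain ⟨U, hU, M, rfl⟩ := exists_of_mem_joins hW
    have hb := IsBorder.append_append U M
    rcases hW' with ⟨V, hV, h⟩ | ⟨V, hV, h⟩
    · have hUV : U = V := primitiveWords_border_unique hL hne (hP hU) (hP hV) hb
        (by simpa only [h] using IsBorder.overlap (hP hV).1)
      subst hUV
      have h1 := congrArg List.length h
      have h2 := (hP hU).1.2
      simp at h1
      omega
    · have hUV : U = V := primitiveWords_border_unique hL hne (hP hU) (hR hV) hb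
        (by simpa only [h] using (hR2 V hV).overlap_two)
      subst hUV
      have h1 := congrArg List.length h
      have h2 := (hP hU).1.2
      simp at h1
      omega
  have d3 : Disjoint S (joins P ∪ (overlaps L.length P ∪ overlaps (2 * L.length) R)) := by
    rw [Set.disjoint_left]
    intro W hW hW'
    rcases hW' with h | ⟨V, hV, rfl⟩ | ⟨V, hV, rfl⟩
    · obtain ⟨V, hV, M, rfl⟩ := exists_of_mem_joins h
      have h2 := (hP hV).1.2
      exact notMem_primitiveWords hL hne (hP hV).1 (IsBorder.append_append V M)
        (by simp; omega) (hS hW)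
    · have h2 := (hP hV).1.2
      exact notMem_primitiveWords hL hne (hP hV).1 (IsBorder.overlap (hP hV).1)
        (by simp; omega) (hS hW)
    · have h2 := (hR hV).1.2
      exact notMem_primitiveWords hL hne (hR hV).1 (hR2 V hV).overlap_two
        (by simp; omega) (hS hW)
  rw [wordGF_union hy d3, wordGF_union hy d2, wordGF_union hy d1,
    wordGF_joins hL hne h0.le hy hy2 hP, wordGF_overlaps h0.ne', wordGF_overlaps h0.ne']
  · ring
  · exact fun V hV => (hR hV).1.2.le
  · intro V hV
    have h2 := (hP hV).1.2
    omega

theorem wordGF_cWords (hL : BifixFree L) (hne : L ≠ []) (h0 : 0 < y)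
    (hy : Summable fun W : List α => y ^ W.length)
    (hy2 : Summable fun W : List α => (y ^ 2) ^ W.length) :
    (y ^ (2 * L.length) - y ^ (4 * L.length)) * (wordGF y (Set.univ : Set (List α)) - 1) =
      wordGF y (cWords L) + (wordGF (y ^ 2) (cWords L) - y ^ (6 * L.length)) *
        (wordGF y (Set.univ : Set (List α)) + (y ^ L.length)⁻¹) + y ^ (4 * L.length) := by
  have hT := triple_mem_cWords hL hne
  have h1 := wordGF_decomposition hL hne h0 hy hy2 (S := cWords L)
    (P := cWords L \ {L ++ L ++ L}) (R := {L ++ L ++ L}) Set.sdiff_subset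
    (Set.sdiff_subset.trans Set.sdiff_subset) (by simpa using hT.1)
    (by simpa using isBorder_append_self_triple L)
  have h2 := wordGF_union hy
    (Set.disjoint_sdiff_left (s := sandwich (L ++ L)) (t := sandwich L))
  rw [Set.sdiff_union_of_subset (sandwich_append_self_subset L), wordGF_sandwich hy,
    wordGF_sandwich hy, sandwich_diff_eq hL hne, h1, wordGF_diff_singleton hy2 hT,
    wordGF_singleton] at h2
  have e1 : (L ++ L).length = 2 * L.length := by simp; omega
  have e2 : (L ++ L ++ L).length = 3 * L.length := by simp; omega
  have e3 : (y ^ 2) ^ (3 * L.length) * (y ^ (2 * L.length))⁻¹ = y ^ (4 * L.length) := by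
    rw [mul_inv_eq_iff_eq_mul₀ (pow_ne_zero _ h0.ne')]
    ring
  rw [e2, e3, e1, ← pow_mul, ← mul_assoc 2 2, ← mul_assoc 2 3] at h2
  norm_num at h2
  linear_combination h2

theorem wordGF_dWords (hL : BifixFree L) (hne : L ≠ []) (h0 : 0 < y)
    (hy : Summable fun W : List α => y ^ W.length)
    (hy2 : Summable fun W : List α => (y ^ 2) ^ W.length) :
    y ^ (4 * L.length) * (wordGF y (Set.univ : Set (List α)) - 1) =
      wordGF y (dWords L) + (wordGF (y ^ 2) (dWords L) + y ^ (6 * L.length)) *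
        (wordGF y (Set.univ : Set (List α)) + (y ^ L.length)⁻¹) +
        wordGF (y ^ 2) (dWords L) * (y ^ (2 * L.length))⁻¹ := by
  have hT := triple_mem_cWords hL hne
  have h1 := wordGF_decomposition hL hne h0 hy hy2 (S := dWords L)
    (P := insert (L ++ L ++ L) (dWords L)) (R := dWords L) Set.inter_subset_left
    (Set.insert_subset hT.1 Set.inter_subset_left) Set.inter_subset_left
    (fun V hV => hV.2.1)
  rw [← sandwich_append_self_eq hL hne, wordGF_sandwich hy,
    wordGF_insert hy2 (fun h => hT.2 h.2)] at h1
  have e1 : (L ++ L).length = 2 * L.length := by simp; omega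
  have e2 : (L ++ L ++ L).length = 3 * L.length := by simp; omega
  rw [e2, e1, ← pow_mul, ← mul_assoc 2 2, ← mul_assoc 2 3] at h1
  norm_num at h1
  linear_combination h1

end GeneratingFunction

section Counting

variable {α : Type*} [Finite α] {y : ℝ}

theorem hasSum_card_mul_pow (hy : Summable fun W : List α => y ^ W.length) (S : Set (List α)) :
    HasSum (fun n => (Nat.card {W : List α // W.length = n ∧ W ∈ S} : ℝ) * y ^ n)
      (wordGF y S) := by
  have h : HasSum (fun W : S => y ^ W.1.length) (wordGF y S) := (hy.subtype S).hasSum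
  rw [← (Equiv.sigmaFiberEquiv fun W : S => W.1.length).hasSum_iff] at h
  refine h.sigma fun n => ?_
  let e : {W : List α // W.length = n ∧ W ∈ S} ≃ {W : S // W.1.length = n} :=
    { toFun := fun W => ⟨⟨W.1, W.2.2⟩, W.2.1⟩
      invFun := fun W => ⟨W.1.1, W.2, W.1.2⟩
      left_inv := fun _ => rfl
      right_inv := fun _ => rfl }
  have hfin : Finite {W : List α // W.length = n ∧ W ∈ S} :=
    ((List.finite_length_eq α n).subset fun W hW => hW.1).to_subtype
  have := Fintype.ofFinite {W : List α // W.length = n ∧ W ∈ S}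
  rw [← e.hasSum_iff]
  convert hasSum_fintype _ using 1
  rw [Finset.sum_congr rfl (g := fun _ => y ^ n), Finset.sum_const, Finset.card_univ,
    Nat.card_eq_fintype_card, nsmul_eq_mul]
  intro W _
  simp [e, W.2.1]

theorem summable_pow_length (h0 : 0 ≤ y) (hy : Nat.card α * y < 1) :
    Summable fun W : List α => y ^ W.length := by
  have := Fintype.ofFinite α
  rw [← (Equiv.sigmaFiberEquiv fun W : List α => W.length).summable_iff]
  have hfib (n : ℕ) (W : {W : List α // W.length = n}) : y ^ W.1.length = y ^ n := by rw [W.2]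
  have hcard (n : ℕ) : Nat.card {W : List α // W.length = n} = Fintype.card α ^ n := by
    rw [← card_vector, ← Nat.card_eq_fintype_card]
    rfl
  have (n : ℕ) : Fintype {W : List α // W.length = n} :=
    inferInstanceAs (Fintype (List.Vector α n))
  refine (summable_sigma_of_nonneg fun _ => pow_nonneg h0 _).2 ⟨fun n => ?_, ?_⟩
  · exact (hasSum_fintype _).summable
  · convert summable_geometric_of_lt_one (by positivity) hy using 2 with n
    simp only [Equiv.sigmaFiberEquiv, Equiv.coe_fn_mk, hfib]
    rw [tsum_const, hcard, mul_pow, nsmul_eq_mul, Nat.cast_pow, Nat.card_eq_fintype_card]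

theorem wordGF_univ (h0 : 0 ≤ y) (hy : Nat.card α * y < 1) :
    wordGF y (Set.univ : Set (List α)) = (1 - Nat.card α * y)⁻¹ := by
  have := Fintype.ofFinite α
  refine (hasSum_card_mul_pow (summable_pow_length h0 hy) Set.univ).unique ?_
  convert hasSum_geometric_of_lt_one (by positivity) hy using 2 with n
  rw [mul_pow, ← Nat.cast_pow, Nat.card_eq_fintype_card (α := α), ← card_vector,
    ← Nat.card_eq_fintype_card]
  simp [List.Vector]

end Counting

section FunctionalEquation

/-- Iterating `D i * F i = R i - S i * F (i + 1)` along a sequence of repeated squares expands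
`F 0` into a convergent series. -/
theorem hasSum_of_functional_equation {X F R S D : ℕ → ℝ} {K : ℝ} {a : ℕ}
    (hXpos : ∀ i, 0 < X i) (hX0 : X 0 ≤ 1 / 4) (hX : ∀ i, X (i + 1) = X i ^ 2)
    (hD : ∀ i, 1 / 2 ≤ D i) (hF : ∀ i, D i * F i = R i - S i * F (i + 1))
    (hS : ∀ i, |S i| ≤ (X i ^ a)⁻¹) (hRb : ∀ i, |R i| ≤ K * X i ^ (a + 1))
    (hFb : ∀ i, |F i| ≤ K * X i ^ (a + 1)) :
    HasSum (fun i => (-1) ^ i * R i * (∏ j ∈ Finset.range i, S j) /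
      ∏ k ∈ Finset.range (i + 1), D k) (F 0) := by
  have hXle (i : ℕ) : X i ≤ (1 / 4) ^ (i + 1) := by
    induction i with
    | zero => simpa using hX0
    | succ i ih =>
      have h1 : X i ≤ 1 / 4 := ih.trans (by
        rw [pow_succ]
        have : ((1 : ℝ) / 4) ^ i ≤ 1 := pow_le_one₀ (by norm_num) (by norm_num)
        linarith)
      rw [hX, sq, pow_succ]
      exact mul_le_mul ih h1 (hXpos i).le (by positivity)
  have hK : 0 ≤ K := by
    have := (abs_nonneg _).trans (hFb 0)
    have h2 := pow_pos (hXpos 0) (a + 1)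
    exact nonneg_of_mul_nonneg_left this h2
  have hSp (i : ℕ) : |∏ j ∈ Finset.range i, S j| ≤ (X i ^ a)⁻¹ := by
    induction i with
    | zero =>
      simp only [Finset.range_zero, Finset.prod_empty, abs_one]
      exact (one_le_inv₀ (pow_pos (hXpos 0) a)).2
        (pow_le_one₀ (hXpos 0).le (hX0.trans (by norm_num)))
    | succ i ih =>
      rw [Finset.prod_range_succ, abs_mul, hX, ← pow_mul, mul_comm 2 a, pow_mul, sq, mul_inv]
      exact mul_le_mul ih (hS i) (abs_nonneg _) (inv_nonneg.2 (pow_pos (hXpos i) a).le)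
  have hDpos (i : ℕ) : 0 < ∏ k ∈ Finset.range i, D k :=
    Finset.prod_pos fun k _ => lt_of_lt_of_le (by norm_num) (hD k)
  have hDp (i : ℕ) : ((1 : ℝ) / 2) ^ i ≤ ∏ k ∈ Finset.range i, D k := by
    have := Finset.prod_le_prod (s := Finset.range i) (f := fun _ => (1 : ℝ) / 2) (g := D)
      (fun _ _ => by norm_num) (fun k _ => hD k)
    simpa using this
  have hbound (i n : ℕ) (hn : n ≤ i + 1) (T : ℝ) (hT : |T| ≤ K * X i ^ (a + 1)) :
      ‖(-1) ^ i * T * (∏ j ∈ Finset.range i, S j) / ∏ k ∈ Finset.range n, D k‖ ≤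
        K * (1 / 2) ^ (i + 1) := by
    rw [Real.norm_eq_abs, abs_div, abs_mul, abs_mul, abs_pow, abs_neg, abs_one, one_pow, one_mul,
      abs_of_pos (hDpos n), div_le_iff₀ (hDpos n)]
    have h1 : |T| * |∏ j ∈ Finset.range i, S j| ≤ K * X i := by
      refine (mul_le_mul hT (hSp i) (abs_nonneg _) ((abs_nonneg _).trans hT)).trans_eq ?_
      have := (pow_pos (hXpos i) a).ne'
      field_simp
      ring
    have h2 : ((1 : ℝ) / 2) ^ (i + 1) ≤ ∏ k ∈ Finset.range n, D k :=
      (pow_le_pow_of_le_one (by norm_num) (by norm_num) hn).trans (hDp n)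
    calc |T| * |∏ j ∈ Finset.range i, S j| ≤ K * X i := h1
      _ ≤ K * (1 / 4) ^ (i + 1) := mul_le_mul_of_nonneg_left (hXle i) hK
      _ = K * (1 / 2) ^ (i + 1) * (1 / 2) ^ (i + 1) := by
        rw [mul_assoc, ← mul_pow]
        norm_num
      _ ≤ _ := mul_le_mul_of_nonneg_left h2 (by positivity)
  have hgeo : Summable fun i : ℕ => K * ((1 : ℝ) / 2) ^ (i + 1) :=
    ((summable_nat_add_iff 1).2
      (summable_geometric_of_lt_one (by norm_num) (by norm_num))).mul_left K
  have hsum := Summable.of_norm_bounded hgeo fun i => hbound i (i + 1) le_rfl (R i) (hRb i)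
  rw [hsum.hasSum_iff_tendsto_nat]
  have hpart (n : ℕ) : ∑ i ∈ Finset.range n, (-1) ^ i * R i * (∏ j ∈ Finset.range i, S j) /
      (∏ k ∈ Finset.range (i + 1), D k) =
      F 0 - (-1) ^ n * F n * (∏ j ∈ Finset.range n, S j) / ∏ k ∈ Finset.range n, D k := by
    induction n with
    | zero => simp
    | succ n ih =>
      have h1 := (hDpos n).ne'
      have h2 : D n ≠ 0 := (lt_of_lt_of_le (by norm_num) (hD n)).ne'
      have hR : R n = D n * F n + S n * F (n + 1) := by rw [hF]; ring
      rw [Finset.sum_range_succ, ih, Finset.prod_range_succ D, Finset.prod_range_succ S, hR]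
      field_simp
      ring
  simp only [hpart]
  have htail := squeeze_zero_norm (fun n => hbound n n (Nat.le_succ n) (F n) (hFb n))
    hgeo.tendsto_atTop_zero
  simpa using htail.const_sub (F 0)

end FunctionalEquation

section Evaluation

variable {q : ℕ} {x : ℝ} {L : List (Fin q)}

theorem sPoly_eq (hx : x ≠ 0) (ℓ : ℕ) :
    sPoly q ℓ x = 1 - q * x * (x ^ ℓ)⁻¹ + (x ^ ℓ)⁻¹ := by
  rw [sPoly, zpow_sub₀ hx, zpow_neg, zpow_one, zpow_natCast, div_eq_mul_inv, mul_assoc]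

theorem vPoly_eq (hx : x ≠ 0) (ℓ : ℕ) : vPoly q ℓ x =
    1 - q * x * (x ^ ℓ)⁻¹ + (x ^ ℓ)⁻¹ - q * x * (x ^ (2 * ℓ))⁻¹ + (x ^ (2 * ℓ))⁻¹ := by
  have h : (2 * (ℓ : ℤ)) = ((2 * ℓ : ℕ) : ℤ) := by push_cast; rfl
  rw [vPoly, h, zpow_sub₀ hx, zpow_sub₀ hx, zpow_neg, zpow_neg, zpow_one, zpow_natCast,
    zpow_natCast, div_eq_mul_inv, div_eq_mul_inv, mul_assoc, mul_assoc]

theorem rPoly_eq (q ℓ : ℕ) (x : ℝ) : rPoly q ℓ x = q * x ^ (2 * ℓ + 1) - x ^ (4 * ℓ) +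
    x ^ (5 * ℓ) - q * x ^ (5 * ℓ + 1) + x ^ (6 * ℓ) := by
  unfold rPoly
  norm_cast

theorem uPoly_eq (q ℓ : ℕ) (x : ℝ) : uPoly q ℓ x = q * x ^ (4 * ℓ + 1) - x ^ (5 * ℓ) +
    q * x ^ (5 * ℓ + 1) - x ^ (6 * ℓ) := by
  unfold uPoly
  norm_cast

theorem pow_le_natCast_mul (hq : 2 ≤ q) (hx : 0 < x) (hx1 : x ≤ 1) {ℓ : ℕ} (hℓ : 1 ≤ ℓ) :
    x ^ ℓ ≤ q * x := by
  have h1 : x ^ ℓ ≤ x ^ 1 := pow_le_pow_of_le_one hx.le hx1 hℓ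
  have h2 : (2 : ℝ) ≤ q := by exact_mod_cast hq
  nlinarith

theorem abs_sPoly_le (hq : 2 ≤ q) (hx : 0 < x) (hqx : q * x ≤ 1) {ℓ : ℕ} (hℓ : 1 ≤ ℓ) :
    |sPoly q ℓ x| ≤ (x ^ ℓ)⁻¹ := by
  have h2 : (2 : ℝ) ≤ q := by exact_mod_cast hq
  have hw : 0 < (x ^ ℓ)⁻¹ := inv_pos.2 (pow_pos hx ℓ)
  have h3 : 1 ≤ q * x * (x ^ ℓ)⁻¹ := by
    rw [← div_eq_mul_inv, one_le_div (pow_pos hx ℓ)]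
    exact pow_le_natCast_mul hq hx (by nlinarith) hℓ
  rw [sPoly_eq hx.ne', abs_le]
  constructor <;> nlinarith

theorem abs_vPoly_le (hq : 2 ≤ q) (hx : 0 < x) (hqx : q * x ≤ 1) {ℓ : ℕ} (hℓ : 1 ≤ ℓ) :
    |vPoly q ℓ x| ≤ (x ^ (2 * ℓ))⁻¹ := by
  have h2 : (2 : ℝ) ≤ q := by exact_mod_cast hq
  have hw : 0 < (x ^ ℓ)⁻¹ := inv_pos.2 (pow_pos hx ℓ)
  have h3 : 1 ≤ q * x * (x ^ ℓ)⁻¹ := by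
    rw [← div_eq_mul_inv, one_le_div (pow_pos hx ℓ)]
    exact pow_le_natCast_mul hq hx (by nlinarith) hℓ
  have h4 : (x ^ (2 * ℓ))⁻¹ = (x ^ ℓ)⁻¹ * (x ^ ℓ)⁻¹ := by rw [two_mul, pow_add, mul_inv]
  rw [vPoly_eq hx.ne', h4, abs_le]
  generalize (x ^ ℓ)⁻¹ = w at *
  constructor
  · have h5 : 0 ≤ (1 - q * x) * w := mul_nonneg (by linarith) hw.le
    have h6 : 0 ≤ (1 - q * x) * w * w := mul_nonneg h5 hw.le
    nlinarith
  · have h5 : 0 ≤ (q * x * w - 1) * w := mul_nonneg (by linarith) hw.le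
    nlinarith

theorem abs_rPoly_le (hq : 2 ≤ q) (hx : 0 < x) (hx1 : x ≤ 1) {ℓ : ℕ} (hℓ : 1 ≤ ℓ) :
    |rPoly q ℓ x| ≤ 5 * q * x ^ (ℓ + 1) := by
  have h2 : (2 : ℝ) ≤ q := by exact_mod_cast hq
  have hp (n : ℕ) (hn : ℓ + 1 ≤ n) : x ^ n ≤ x ^ (ℓ + 1) := pow_le_pow_of_le_one hx.le hx1 hn
  have hn (n : ℕ) : 0 < x ^ n := pow_pos hx n
  have e1 := hp (2 * ℓ + 1) (by omega)
  have e2 := hp (4 * ℓ) (by omega)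
  have e3 := hp (5 * ℓ) (by omega)
  have e4 := hp (5 * ℓ + 1) (by omega)
  have e5 := hp (6 * ℓ) (by omega)
  have := hn (2 * ℓ + 1)
  have := hn (4 * ℓ)
  have := hn (5 * ℓ)
  have := hn (5 * ℓ + 1)
  have := hn (6 * ℓ)
  rw [rPoly_eq, abs_le]
  constructor <;> nlinarith

theorem abs_uPoly_le (hq : 2 ≤ q) (hx : 0 < x) (hx1 : x ≤ 1) {ℓ : ℕ} (hℓ : 1 ≤ ℓ) :
    |uPoly q ℓ x| ≤ 5 * q * x ^ (2 * ℓ + 1) := by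
  have h2 : (2 : ℝ) ≤ q := by exact_mod_cast hq
  have hp (n : ℕ) (hn : 2 * ℓ + 1 ≤ n) : x ^ n ≤ x ^ (2 * ℓ + 1) :=
    pow_le_pow_of_le_one hx.le hx1 hn
  have hn (n : ℕ) : 0 < x ^ n := pow_pos hx n
  have e1 := hp (4 * ℓ + 1) (by omega)
  have e2 := hp (5 * ℓ) (by omega)
  have e3 := hp (5 * ℓ + 1) (by omega)
  have e4 := hp (6 * ℓ) (by omega)
  have := hn (4 * ℓ + 1)
  have := hn (5 * ℓ)
  have := hn (5 * ℓ + 1)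
  have := hn (6 * ℓ)
  rw [uPoly_eq, abs_le]
  constructor <;> nlinarith

theorem summable_pow_length_fin (h0 : 0 ≤ x) (hx : q * x ≤ 1 / 2) :
    Summable fun W : List (Fin q) => x ^ W.length :=
  summable_pow_length h0 (by rw [Nat.card_fin]; linarith)

theorem summable_sq_pow_length_fin (h0 : 0 ≤ x) (hx : q * x ≤ 1 / 2) (hx1 : x ≤ 1) :
    Summable fun W : List (Fin q) => (x ^ 2) ^ W.length := by
  refine summable_pow_length_fin (sq_nonneg x) (le_trans ?_ hx)
  exact mul_le_mul_of_nonneg_left (by nlinarith) q.cast_nonneg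

theorem wordGF_univ_mul (h0 : 0 ≤ x) (hx : q * x ≤ 1 / 2) :
    (1 - q * x) * wordGF x (Set.univ : Set (List (Fin q))) = 1 := by
  rw [wordGF_univ h0 (by rw [Nat.card_fin]; linarith), Nat.card_fin]
  exact mul_inv_cancel₀ (by linarith)

theorem wordGF_sandwich_le (h0 : 0 < x) (hx : q * x ≤ 1 / 2) (L : List (Fin q)) :
    wordGF x (sandwich L) ≤ 2 * q * x ^ (2 * L.length + 1) := by
  rw [wordGF_sandwich (summable_pow_length_fin h0.le hx)]
  have h1 := wordGF_univ_mul h0.le hx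
  have h2 := wordGF_nonneg h0.le (Set.univ : Set (List (Fin q)))
  have h3 := pow_pos h0 (2 * L.length)
  have h4 : wordGF x (Set.univ : Set (List (Fin q))) - 1 ≤ 2 * (q * x) := by
    have h5 : 0 ≤ q * x := by positivity
    nlinarith
  calc _ ≤ x ^ (2 * L.length) * (2 * (q * x)) := mul_le_mul_of_nonneg_left h4 h3.le
    _ = _ := by ring

theorem cWords_functional_equation (hL : BifixFree L) (hne : L ≠ []) (h0 : 0 < x)
    (hx : q * x ≤ 1 / 2) (hx1 : x ≤ 1) : (1 - q * x) * wordGF x (cWords L) =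
      rPoly q L.length x - sPoly q L.length x * wordGF (x ^ 2) (cWords L) := by
  have h1 := wordGF_cWords hL hne h0 (summable_pow_length_fin h0.le hx)
    (summable_sq_pow_length_fin h0.le hx hx1)
  have h2 := wordGF_univ_mul h0.le hx
  rw [rPoly_eq, sPoly_eq h0.ne']
  have hp (k : ℕ) : x ^ (k * L.length) = (x ^ L.length) ^ k := by rw [mul_comm, pow_mul]
  have hp1 (k : ℕ) : x ^ (k * L.length + 1) = (x ^ L.length) ^ k * x := by rw [pow_succ, hp]
  simp only [hp, hp1] at h1 ⊢
  have hpos := (pow_pos h0 L.length).ne'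
  generalize wordGF x (Set.univ : Set (List (Fin q))) = N at *
  generalize x ^ L.length = p at *
  have hi := mul_inv_cancel₀ hpos
  linear_combination -(1 - q * x) * h1 + (p ^ 2 - p ^ 4 - (wordGF (x ^ 2) (cWords L) - p ^ 6)) * h2 + (1 - q * x) * p ^ 5 * hi

theorem dWords_functional_equation (hL : BifixFree L) (hne : L ≠ []) (h0 : 0 < x)
    (hx : q * x ≤ 1 / 2) (hx1 : x ≤ 1) : (1 - q * x) * wordGF x (dWords L) =
      uPoly q L.length x - vPoly q L.length x * wordGF (x ^ 2) (dWords L) := by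
  have h1 := wordGF_dWords hL hne h0 (summable_pow_length_fin h0.le hx)
    (summable_sq_pow_length_fin h0.le hx hx1)
  have h2 := wordGF_univ_mul h0.le hx
  rw [uPoly_eq, vPoly_eq h0.ne']
  have hp (k : ℕ) : x ^ (k * L.length) = (x ^ L.length) ^ k := by rw [mul_comm, pow_mul]
  have hp1 (k : ℕ) : x ^ (k * L.length + 1) = (x ^ L.length) ^ k * x := by rw [pow_succ, hp]
  simp only [hp, hp1] at h1 ⊢
  have hpos := (pow_pos h0 L.length).ne'
  generalize wordGF x (Set.univ : Set (List (Fin q))) = N at *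
  generalize x ^ L.length = p at *
  have hi := mul_inv_cancel₀ hpos
  linear_combination -(1 - q * x) * h1 + (p ^ 4 - (wordGF (x ^ 2) (dWords L) + p ^ 6)) * h2 - (1 - q * x) * p ^ 5 * hi

theorem cCount_eq (L : List (Fin q)) (n : ℕ) :
    cCount q L n = Nat.card {W : List (Fin q) // W.length = n ∧ W ∈ cWords L} := by
  refine Nat.card_congr (Equiv.subtypeEquivRight fun W => and_congr_right fun _ => ?_)
  have h : (∃ A', A' ≠ [] ∧ W = L ++ L ++ A' ++ L ++ L) ↔ W ∈ sandwich (L ++ L) := by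
    rw [sandwich, Set.mem_ofPred_eq, ← exists_append_append_iff]
    simp only [List.append_assoc]
  rw [h, exists_append_append_iff]
  exact ⟨fun h => ⟨⟨h.1, h.2.2⟩, h.2.1⟩, fun h => ⟨h.1.1, h.2, h.1.2⟩⟩

theorem dCount_eq (L : List (Fin q)) (n : ℕ) :
    dCount q L n = Nat.card {W : List (Fin q) // W.length = n ∧ W ∈ dWords L} := by
  refine Nat.card_congr (Equiv.subtypeEquivRight fun W => and_congr_right fun _ => ?_)
  have h : (∃ A', A' ≠ [] ∧ W = L ++ L ++ A' ++ L ++ L) ↔ W ∈ sandwich (L ++ L) := by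
    rw [sandwich, Set.mem_ofPred_eq, ← exists_append_append_iff]
    simp only [List.append_assoc]
  rw [h, exists_append_append_iff]
  exact ⟨fun h => ⟨⟨h.1, h.2.2⟩, h.2.1⟩, fun h => ⟨h.1.1, h.2, h.1.2⟩⟩

/-- The weighted count of a set of nonempty words at `q⁻²`, as a series starting at length `1`. -/
theorem hasSum_card_succ (hq : 2 ≤ q) {S : Set (List (Fin q))} (hS : [] ∉ S) :
    HasSum (fun m : ℕ => (Nat.card {W : List (Fin q) // W.length = m + 1 ∧ W ∈ S} : ℝ) *
      (q : ℝ) ^ (-(2 : ℤ) * (m + 1))) (wordGF ((q : ℝ) ^ (-2 : ℤ)) S) := by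
  have h2 : (2 : ℝ) ≤ q := by exact_mod_cast hq
  have hx : q * (q : ℝ) ^ (-2 : ℤ) ≤ 1 / 2 := by
    rw [← zpow_one_add₀ (by positivity)]
    norm_num only [zpow_neg_one]
    rw [one_div]
    exact inv_anti₀ (by norm_num) h2
  have h := hasSum_card_mul_pow (summable_pow_length_fin (by positivity) hx) S
  rw [← hasSum_nat_add_iff' 1] at h
  have h0 : Nat.card {W : List (Fin q) // W.length = 0 ∧ W ∈ S} = 0 := by
    rw [Nat.card_eq_zero]
    refine Or.inl ⟨fun W => hS ?_⟩
    rw [← List.length_eq_zero_iff.1 W.2.1]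
    exact W.2.2
  simp only [Finset.range_one, Finset.sum_singleton, h0, Nat.cast_zero, zero_mul, sub_zero] at h
  refine h.congr_fun fun m => ?_
  rw [zpow_mul]
  norm_cast

variable (q) in
theorem zpow_neg_two_pow_succ (i : ℕ) : (q : ℝ) ^ (-(2 : ℤ) ^ (i + 1 + 1)) =
    ((q : ℝ) ^ (-(2 : ℤ) ^ (i + 1))) ^ 2 := by
  rw [← zpow_natCast, ← zpow_mul]
  congr 1
  push_cast
  ring

theorem natCast_mul_zpow_le (hq : 2 ≤ q) (i : ℕ) :
    q * (q : ℝ) ^ (-(2 : ℤ) ^ (i + 1)) ≤ 1 / 2 := by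
  have h2 : (2 : ℝ) ≤ q := by exact_mod_cast hq
  rw [← zpow_one_add₀ (by positivity)]
  have h1 : (2 : ℤ) ≤ 2 ^ (i + 1) := by
    rw [pow_succ]
    have : (1 : ℤ) ≤ 2 ^ i := one_le_pow₀ (by norm_num)
    linarith
  calc (q : ℝ) ^ (1 + -(2 : ℤ) ^ (i + 1)) ≤ (q : ℝ) ^ (-1 : ℤ) :=
        zpow_le_zpow_right₀ (by linarith) (by linarith)
    _ ≤ 1 / 2 := by
        rw [zpow_neg_one, one_div]
        exact inv_anti₀ (by norm_num) h2

theorem zpow_le_quarter (hq : 2 ≤ q) (i : ℕ) : (q : ℝ) ^ (-(2 : ℤ) ^ (i + 1)) ≤ 1 / 4 := by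
  have h2 : (2 : ℝ) ≤ q := by exact_mod_cast hq
  have := natCast_mul_zpow_le hq i
  have : 0 < (q : ℝ) ^ (-(2 : ℤ) ^ (i + 1)) := by positivity
  nlinarith

theorem natCast_zpow_one_sub (hq : 2 ≤ q) (k : ℕ) :
    (q : ℝ) ^ ((1 : ℤ) - 2 ^ (k + 1)) = q * (q : ℝ) ^ (-(2 : ℤ) ^ (k + 1)) := by
  rw [sub_eq_add_neg, zpow_one_add₀ (by positivity)]

theorem hasSum_Gterm (hq : 2 ≤ q) (hL : BifixFree L) (hne : L ≠ []) :
    HasSum (Gterm q L.length) (wordGF ((q : ℝ) ^ (-2 : ℤ)) (cWords L)) := by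
  have hq2 : (2 : ℝ) ≤ q := by exact_mod_cast hq
  have hℓ := List.length_pos_iff.2 hne
  have hpos (i : ℕ) : 0 < (q : ℝ) ^ (-(2 : ℤ) ^ (i + 1)) := by positivity
  have hqx := natCast_mul_zpow_le hq
  have hx1 (i : ℕ) := (zpow_le_quarter hq i).trans (show (1 : ℝ) / 4 ≤ 1 by norm_num)
  have h := hasSum_of_functional_equation (a := L.length) (K := 5 * q)
    (X := fun i => (q : ℝ) ^ (-(2 : ℤ) ^ (i + 1)))
    (F := fun i => wordGF ((q : ℝ) ^ (-(2 : ℤ) ^ (i + 1))) (cWords L))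
    (R := fun i => rPoly q L.length ((q : ℝ) ^ (-(2 : ℤ) ^ (i + 1))))
    (S := fun i => sPoly q L.length ((q : ℝ) ^ (-(2 : ℤ) ^ (i + 1))))
    (D := fun i => 1 - (q : ℝ) ^ ((1 : ℤ) - 2 ^ (i + 1)))
    hpos (zpow_le_quarter hq 0) (zpow_neg_two_pow_succ q)
    (fun i => by
      have := hqx i
      simp only [natCast_zpow_one_sub hq]
      linarith)
    (fun i => by
      simp only [natCast_zpow_one_sub hq, zpow_neg_two_pow_succ q i]
      exact cWords_functional_equation hL hne (hpos i) (hqx i) (hx1 i))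
    (fun i => abs_sPoly_le hq (hpos i) ((hqx i).trans (by norm_num)) hℓ)
    (fun i => abs_rPoly_le hq (hpos i) (hx1 i) hℓ)
    (fun i => by
      rw [abs_of_nonneg (wordGF_nonneg (hpos i).le _)]
      calc _ ≤ _ := wordGF_mono (hpos i).le (summable_pow_length_fin (hpos i).le (hqx i))
              (fun W hW => hW.1.1)
        _ ≤ _ := wordGF_sandwich_le (hpos i) (hqx i) L
        _ ≤ _ := mul_le_mul (by linarith)
              (pow_le_pow_of_le_one (hpos i).le (hx1 i) (by omega)) (pow_pos (hpos i) _).le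
              (by positivity))
  exact h

theorem hasSum_Hterm (hq : 2 ≤ q) (hL : BifixFree L) (hne : L ≠ []) :
    HasSum (Hterm q L.length) (wordGF ((q : ℝ) ^ (-2 : ℤ)) (dWords L)) := by
  have hq2 : (2 : ℝ) ≤ q := by exact_mod_cast hq
  have hℓ := List.length_pos_iff.2 hne
  have hpos (i : ℕ) : 0 < (q : ℝ) ^ (-(2 : ℤ) ^ (i + 1)) := by positivity
  have hqx := natCast_mul_zpow_le hq
  have hx1 (i : ℕ) := (zpow_le_quarter hq i).trans (show (1 : ℝ) / 4 ≤ 1 by norm_num)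
  have h := hasSum_of_functional_equation (a := 2 * L.length) (K := 5 * q)
    (X := fun i => (q : ℝ) ^ (-(2 : ℤ) ^ (i + 1)))
    (F := fun i => wordGF ((q : ℝ) ^ (-(2 : ℤ) ^ (i + 1))) (dWords L))
    (R := fun i => uPoly q L.length ((q : ℝ) ^ (-(2 : ℤ) ^ (i + 1))))
    (S := fun i => vPoly q L.length ((q : ℝ) ^ (-(2 : ℤ) ^ (i + 1))))
    (D := fun i => 1 - (q : ℝ) ^ ((1 : ℤ) - 2 ^ (i + 1)))
    hpos (zpow_le_quarter hq 0) (zpow_neg_two_pow_succ q)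
    (fun i => by
      have := hqx i
      simp only [natCast_zpow_one_sub hq]
      linarith)
    (fun i => by
      simp only [natCast_zpow_one_sub hq, zpow_neg_two_pow_succ q i]
      exact dWords_functional_equation hL hne (hpos i) (hqx i) (hx1 i))
    (fun i => abs_vPoly_le hq (hpos i) ((hqx i).trans (by norm_num)) hℓ)
    (fun i => abs_uPoly_le hq (hpos i) (hx1 i) hℓ)
    (fun i => by
      rw [abs_of_nonneg (wordGF_nonneg (hpos i).le _)]
      calc _ ≤ _ := wordGF_mono (hpos i).le (summable_pow_length_fin (hpos i).le (hqx i))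
              (fun W hW => hW.1.1)
        _ ≤ _ := wordGF_sandwich_le (hpos i) (hqx i) L
        _ ≤ _ := mul_le_mul_of_nonneg_right (by linarith) (pow_pos (hpos i) _).le)
  exact h

end Evaluation

/-- For `q ≥ 2` and a nonempty bifix-free word `L` of length `ℓ` over `[q]`, the
series `∑_{m≥1} c_m^ℓ q^{−2m}`, `∑_{m≥1} d_m^ℓ q^{−2m}`, `∑_{i≥0} G_ℓ(i)` and
`∑_{i≥0} H_ℓ(i)` all converge, with
`∑_{m≥1} c_m^ℓ q^{−2m} = ∑_{i≥0} G_ℓ(i)` and `∑_{m≥1} d_m^ℓ q^{−2m} = ∑_{i≥0} H_ℓ(i)`. -/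
theorem cd_series_eq_GH (q : ℕ) (hq : 2 ≤ q) (L : List (Fin q)) (hL : L ≠ [])
    (hbf : BifixFree L) :
    Summable (fun m : ℕ => (cCount q L (m + 1) : ℝ) * (q : ℝ) ^ (-(2 : ℤ) * (m + 1))) ∧
    Summable (fun m : ℕ => (dCount q L (m + 1) : ℝ) * (q : ℝ) ^ (-(2 : ℤ) * (m + 1))) ∧
    Summable (fun i : ℕ => Gterm q L.length i) ∧
    Summable (fun i : ℕ => Hterm q L.length i) ∧
    (∑' m : ℕ, (cCount q L (m + 1) : ℝ) * (q : ℝ) ^ (-(2 : ℤ) * (m + 1))) =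
      (∑' i : ℕ, Gterm q L.length i) ∧
    (∑' m : ℕ, (dCount q L (m + 1) : ℝ) * (q : ℝ) ^ (-(2 : ℤ) * (m + 1))) =
      (∑' i : ℕ, Hterm q L.length i) := by
  have hnil : [] ∉ primitiveWords L := fun h => by simpa using h.1.2
  have hc := hasSum_card_succ hq (S := cWords L) fun h => hnil h.1
  have hd := hasSum_card_succ hq (S := dWords L) fun h => hnil h.1
  simp only [← cCount_eq, ← dCount_eq] at hc hd
  have hG := hasSum_Gterm hq hbf hL
  have hH := hasSum_Hterm hq hbf hL
  exact ⟨hc.summable, hd.summable, hG.summable, hH.summable, hc.tsum_eq.trans hG.tsum_eq.symm,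
    hd.tsum_eq.trans hH.tsum_eq.symm⟩
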